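/- arXiv:0711.4197 — 2 statements merged into one kernel-verified Lean document; each statement's English description precedes it below -/
import Mathlib

section
/- Let d ∈ ℕ and let constants (C_α)_{α∈ℕ} and C be given. There exists a constant c, depending only on d and on finitely many of the constants C_α and on C, with the following property: for every 0 < ε < N, every smooth function k : ℝ → ℂ supported in {t : ε ≤ |t| ≤ N} satisfying |∂^α k(t)| ≤ C_α|t|^{−1−α} for all α ∈ ℕ and t ≠ 0 and |∫_ℝ k(t)φ(δt) dt| ≤ C for every δ > 0 and every normalized bump function φ, and every real polynomial P of degree at most d, one has |∫_ℝ e^{iP(t)} k(t) dt| ≤ c. In particular, the bound is independent of ε, N and of the coefficients of P. -/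
open Real Filter Topology MeasureTheory ENNReal NNReal

noncomputable section

/-- `eI r = exp(i r)`. -/
def eI (r : ℝ) : ℂ := Complex.exp (Complex.I * r)

/-- A normalized bump function on `ℝ`: a `C^∞` function supported in `[-1,1]`
with `|φ| ≤ 1` and `|φ'| ≤ 1`. -/
def IsNormalizedBump (φ : ℝ → ℝ) : Prop :=
  ContDiff ℝ (⊤ : ℕ∞) φ ∧ (∀ t : ℝ, 1 < |t| → φ t = 0) ∧
  (∀ t, |φ t| ≤ 1) ∧ (∀ t, |deriv φ t| ≤ 1)

/-- A truncated Calderón–Zygmund kernel on `ℝ` with constants `(Cd, C)`: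
a smooth function supported in the shell `ε ≤ |t| ≤ N`, satisfying the CZ decay
estimates `|∂^α k(t)| ≤ Cd α * |t|^{-1-α}` and the cancellation condition
`|∫ k(t) φ(δ t) dt| ≤ C` for all normalized bump functions `φ` and all `δ > 0`. -/
def IsTruncCZ (Cd : ℕ → ℝ) (C : ℝ) (ε N : ℝ) (k : ℝ → ℂ) : Prop :=
  ContDiff ℝ (⊤ : ℕ∞) k ∧
  (∀ t : ℝ, ¬(ε ≤ |t| ∧ |t| ≤ N) → k t = 0) ∧
  (∀ (α : ℕ) (t : ℝ), t ≠ 0 → ‖iteratedDeriv α k t‖ ≤ Cd α * |t| ^ (-1 - (α : ℝ))) ∧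
  (∀ δ : ℝ, 0 < δ → ∀ φ : ℝ → ℝ, IsNormalizedBump φ →
    ‖∫ t : ℝ, k t * (φ (δ * t) : ℂ)‖ ≤ C)

lemma norm_eI (r : ℝ) : ‖eI r‖ = 1 := Complex.norm_exp_I_mul_ofReal r

lemma norm_eI_add_sub_le (x y : ℝ) : ‖eI (x + y) - eI y‖ ≤ |x| := by
  have h : eI (x + y) - eI y = (eI x - 1) * eI y := by
    simp only [eI]
    push_cast
    rw [mul_add, Complex.exp_add]
    ring
  rw [h, norm_mul, norm_eI, mul_one]
  exact Real.norm_exp_I_mul_ofReal_sub_one_le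

lemma continuous_eI_polynomial (P : Polynomial ℝ) : Continuous fun t => eI (P.eval t) := by
  unfold eI
  fun_prop

lemma hasDerivAt_eI_polynomial (P : Polynomial ℝ) (t : ℝ) :
    HasDerivAt (fun t => eI (P.eval t))
      (eI (P.eval t) * (Complex.I * (P.derivative.eval t : ℝ))) t := by
  have h := ((P.hasDerivAt t).ofReal_comp.const_mul Complex.I).cexp
  exact h

/-- Integration by parts estimate: the total variation of `V` is controlled through a
real function `W` whose derivative dominates `‖V'‖`. -/
lemma norm_integral_deriv_mul_le {U V U' V' : ℝ → ℂ} {W W' : ℝ → ℝ} {a b M : ℝ} (hab : a ≤ b)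
    (hU : ∀ x ∈ Set.Icc a b, HasDerivAt U (U' x) x)
    (hV : ∀ x ∈ Set.Icc a b, HasDerivAt V (V' x) x)
    (hW : ∀ x ∈ Set.Icc a b, HasDerivAt W (W' x) x)
    (hU' : ContinuousOn U' (Set.Icc a b)) (hV' : ContinuousOn V' (Set.Icc a b))
    (hW' : ContinuousOn W' (Set.Icc a b)) (hM : ∀ x ∈ Set.Icc a b, ‖U x‖ ≤ M)
    (hVW : ∀ x ∈ Set.Icc a b, ‖V' x‖ ≤ W' x) :
    ‖∫ x in a..b, U' x * V x‖ ≤ M * (‖V b‖ + ‖V a‖ + (W b - W a)) := by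
  have ha : a ∈ Set.Icc a b := ⟨le_rfl, hab⟩
  have hb : b ∈ Set.Icc a b := ⟨hab, le_rfl⟩
  have hM0 : 0 ≤ M := (norm_nonneg _).trans (hM a ha)
  rw [← Set.uIcc_of_le hab] at hU hV hW hU' hV' hW'
  have hparts := intervalIntegral.integral_mul_deriv_eq_deriv_mul hV hU
    hV'.intervalIntegrable hU'.intervalIntegrable
  have hcomm : ∫ x in a..b, U' x * V x = ∫ x in a..b, V x * U' x := by
    simp only [mul_comm]
  have hrest : ‖∫ x in a..b, V' x * U x‖ ≤ M * (W b - W a) := by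
    rw [← intervalIntegral.integral_eq_sub_of_hasDerivAt hW hW'.intervalIntegrable,
      ← intervalIntegral.integral_const_mul]
    refine intervalIntegral.norm_integral_le_of_norm_le hab (Eventually.of_forall fun x hx => ?_)
      (hW'.intervalIntegrable.const_mul M)
    have hx' := Set.Ioc_subset_Icc_self hx
    rw [norm_mul, mul_comm]
    exact mul_le_mul (hM x hx') (hVW x hx') (norm_nonneg _) hM0
  rw [hcomm, hparts]
  calc ‖V b * U b - V a * U a - ∫ x in a..b, V' x * U x‖
      ≤ ‖V b * U b‖ + ‖V a * U a‖ + ‖∫ x in a..b, V' x * U x‖ :=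
        (norm_sub_le _ _).trans (by gcongr; exact norm_sub_le _ _)
    _ ≤ ‖V b‖ * M + ‖V a‖ * M + M * (W b - W a) := by
        rw [norm_mul, norm_mul]
        gcongr
        exacts [hM b hb, hM a ha]
    _ = _ := by ring

/-- First order van der Corput estimate, for a derivative of constant sign which is monotone. -/
lemma norm_integral_eI_le_of_derivative {P : Polynomial ℝ} {a b μ s : ℝ} (hab : a ≤ b)
    (hμ : 0 < μ) (hs : |s| = 1) (h1 : ∀ x ∈ Set.Icc a b, μ ≤ |P.derivative.eval x|)
    (h2 : ∀ x ∈ Set.Icc a b, 0 ≤ s * P.derivative.derivative.eval x) :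
    ‖∫ x in a..b, eI (P.eval x)‖ ≤ 4 / μ := by
  set p : ℝ → ℝ := fun x => P.derivative.eval x with hp
  set q : ℝ → ℝ := fun x => P.derivative.derivative.eval x with hq
  have hpc : Continuous p := P.derivative.continuous
  have hqc : Continuous q := P.derivative.derivative.continuous
  have hp0 : ∀ x ∈ Set.Icc a b, p x ≠ 0 := fun x hx => abs_pos.1 (hμ.trans_le (h1 x hx))
  have hpC : ∀ x ∈ Set.Icc a b, (Complex.I * (p x : ℂ)) ≠ 0 := fun x hx =>
    mul_ne_zero Complex.I_ne_zero (Complex.ofReal_ne_zero.2 (hp0 x hx))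
  have hpd : ∀ x, HasDerivAt p (q x) x := fun x => P.derivative.hasDerivAt x
  have hbd : ∀ x ∈ Set.Icc a b, |p x|⁻¹ ≤ μ⁻¹ := fun x hx => inv_anti₀ hμ (h1 x hx)
  have key := norm_integral_deriv_mul_le (M := 1) hab
    (U := fun t => eI (P.eval t)) (U' := fun x => eI (P.eval x) * (Complex.I * (p x : ℂ)))
    (V := fun x => (Complex.I * (p x : ℂ))⁻¹)
    (V' := fun x => -(Complex.I * (q x : ℂ)) / (Complex.I * (p x : ℂ)) ^ 2)
    (W := fun x => -s * (p x)⁻¹) (W' := fun x => -s * (-q x / p x ^ 2))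
    (fun x _ => hasDerivAt_eI_polynomial P x)
    (fun x hx => ((hpd x).ofReal_comp.const_mul Complex.I).fun_inv (hpC x hx))
    (fun x hx => ((hpd x).fun_inv (hp0 x hx)).const_mul (-s))
    (((continuous_eI_polynomial P).mul (by fun_prop)).continuousOn)
    (ContinuousOn.div (by fun_prop) (by fun_prop) fun x hx => pow_ne_zero 2 (hpC x hx))
    (continuousOn_const.mul
      (ContinuousOn.div (by fun_prop) (by fun_prop) fun x hx => pow_ne_zero 2 (hp0 x hx)))
    (fun x _ => (norm_eI _).le)
    (fun x hx => by
      have : ‖-(Complex.I * (q x : ℂ)) / (Complex.I * (p x : ℂ)) ^ 2‖ = |q x| / p x ^ 2 := by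
        simp
      rw [this]
      have hq' : |q x| = s * q x := by
        rw [← abs_of_nonneg (h2 x hx), abs_mul, hs, one_mul]
      rw [hq']
      apply le_of_eq
      ring)
  have hint : ∫ x in a..b, eI (P.eval x)
      = ∫ x in a..b, eI (P.eval x) * (Complex.I * (p x : ℂ)) * (Complex.I * (p x : ℂ))⁻¹ := by
    refine intervalIntegral.integral_congr fun x hx => ?_
    rw [Set.uIcc_of_le hab] at hx
    exact (mul_inv_cancel_right₀ (hpC x hx) _).symm
  rw [hint]
  refine key.trans ?_
  have ha : a ∈ Set.Icc a b := ⟨le_rfl, hab⟩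
  have hb : b ∈ Set.Icc a b := ⟨hab, le_rfl⟩
  have hn : ∀ x, ‖(Complex.I * (p x : ℂ))⁻¹‖ = |p x|⁻¹ := fun x => by simp
  have hw : ∀ x ∈ Set.Icc a b, |s * (p x)⁻¹| ≤ μ⁻¹ := fun x hx => by
    rw [abs_mul, hs, one_mul, abs_inv]
    exact hbd x hx
  have e1 := hbd a ha
  have e2 := hbd b hb
  have e3 := abs_le.1 (hw a ha)
  have e4 := abs_le.1 (hw b hb)
  simp only [hn]
  rw [div_eq_mul_inv]
  linarith [e3.2, e4.1]

/-- A monotone continuous function crosses a given level at a point of the interval. -/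
lemma exists_level_crossing {g : ℝ → ℝ} (hg : Continuous g) {a b : ℝ} (hab : a ≤ b) (c : ℝ) :
    ∃ p ∈ Set.Icc a b, (p = a ∨ g p ≤ c) ∧ (p = b ∨ c ≤ g p) := by
  rcases le_total c (g a) with h | h
  · exact ⟨a, ⟨le_rfl, hab⟩, Or.inl rfl, Or.inr h⟩
  rcases le_total (g b) c with h' | h'
  · exact ⟨b, ⟨hab, le_rfl⟩, Or.inr h', Or.inl rfl⟩
  obtain ⟨p, hp, rfl⟩ := intermediate_value_Icc hab hg.continuousOn ⟨h, h'⟩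
  exact ⟨p, hp, Or.inr le_rfl, Or.inr le_rfl⟩

/-- If `g` grows at rate at least `δ * μ`, then `|g| ≥ δ` on two intervals covering all but a
middle interval of length at most `2 / μ`. -/
lemma exists_splitting {g : ℝ → ℝ} (hg : Continuous g) {a b δ μ : ℝ} (hab : a ≤ b)
    (hδ : 0 < δ) (hμ : 0 < μ)
    (hinc : ∀ x ∈ Set.Icc a b, ∀ y ∈ Set.Icc a b, x ≤ y → δ * μ * (y - x) ≤ g y - g x) :
    ∃ p q, a ≤ p ∧ p ≤ q ∧ q ≤ b ∧ q - p ≤ 2 / μ ∧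
      (p = a ∨ ∀ x ∈ Set.Icc a p, g x ≤ -δ) ∧ (q = b ∨ ∀ x ∈ Set.Icc q b, δ ≤ g x) := by
  obtain ⟨p, hp, hp1, hp2⟩ := exists_level_crossing hg hab (-δ)
  obtain ⟨q, hq, hq1, hq2⟩ := exists_level_crossing hg hp.2 δ
  have hmono : ∀ x ∈ Set.Icc a b, ∀ y ∈ Set.Icc a b, x ≤ y → g x ≤ g y := fun x hx y hy hxy => by
    have := hinc x hx y hy hxy
    have : 0 ≤ δ * μ * (y - x) := mul_nonneg (mul_pos hδ hμ).le (sub_nonneg.2 hxy)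
    linarith
  have hqI : q ∈ Set.Icc a b := ⟨hp.1.trans hq.1, hq.2⟩
  refine ⟨p, q, hp.1, hq.1, hq.2, ?_, hp1.imp_right fun h x hx => ?_,
    hq2.imp_right fun h x hx => ?_⟩
  · rcases hq1 with rfl | hq1
    · rw [sub_self]; positivity
    rcases hp2 with rfl | hp2
    · rw [le_antisymm hq.2 hq.1, sub_self]; positivity
    have := hinc p hp q hqI hq.1
    rw [le_div_iff₀ hμ]
    have h3 : δ * ((q - p) * μ) ≤ δ * 2 := by linarith
    exact le_of_mul_le_mul_left h3 hδ
  · exact (hmono x ⟨hx.1, hx.2.trans hp.2⟩ p hp hx.2).trans h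
  · exact h.trans (hmono q hqI x ⟨hqI.1.trans hx.1, hx.2⟩ hx.1)

lemma iterate_derivative_eval_hasDerivAt (P : Polynomial ℝ) (n : ℕ) (x : ℝ) :
    HasDerivAt (fun x => (Polynomial.derivative^[n] P).eval x)
      ((Polynomial.derivative^[n + 1] P).eval x) x := by
  rw [Function.iterate_succ_apply']
  exact Polynomial.hasDerivAt _ x

/-- Van der Corput's lemma for polynomial phases. -/
lemma exists_van_der_Corput (n : ℕ) : ∃ c : ℝ, 0 ≤ c ∧ ∀ (P : Polynomial ℝ) (a b μ : ℝ),
    a ≤ b → 0 < μ →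
    ((∀ x ∈ Set.Icc a b, μ ^ (n + 1) ≤ (Polynomial.derivative^[n + 1] P).eval x) ∨
      (∀ x ∈ Set.Icc a b, (Polynomial.derivative^[n + 1] P).eval x ≤ -μ ^ (n + 1))) →
    (n = 0 → ∃ s : ℝ, |s| = 1 ∧
      ∀ x ∈ Set.Icc a b, 0 ≤ s * P.derivative.derivative.eval x) →
    ‖∫ x in a..b, eI (P.eval x)‖ ≤ c / μ := by
  induction n with
  | zero =>
    refine ⟨4, by norm_num, fun P a b μ hab hμ h1 h2 => ?_⟩
    obtain ⟨s, hs, h2⟩ := h2 rfl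
    refine norm_integral_eI_le_of_derivative hab hμ hs (fun x hx => ?_) h2
    simp only [zero_add, pow_one, Function.iterate_one] at h1
    rcases h1 with h1 | h1
    · exact (h1 x hx).trans (le_abs_self _)
    · exact (le_neg.1 (h1 x hx)).trans (neg_le_abs _)
  | succ n ih =>
    obtain ⟨c, hc, ih⟩ := ih
    refine ⟨2 * c + 2, by positivity, fun P a b μ hab hμ h1 _ => ?_⟩
    set g : ℝ → ℝ := fun x => (Polynomial.derivative^[n + 1] P).eval x with hgdef
    have hg : Continuous g := Polynomial.continuous _
    have hgd : ∀ x, HasDerivAt g ((Polynomial.derivative^[n + 1 + 1] P).eval x) x :=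
      iterate_derivative_eval_hasDerivAt P (n + 1)
    obtain ⟨s, hs, hsg⟩ : ∃ s : ℝ, (s = 1 ∨ s = -1) ∧ ∀ x ∈ Set.Icc a b,
        μ ^ (n + 1) * μ ≤ s * (Polynomial.derivative^[n + 1 + 1] P).eval x := by
      rcases h1 with h1 | h1
      · exact ⟨1, Or.inl rfl, fun x hx => by rw [one_mul, ← pow_succ]; exact h1 x hx⟩
      · refine ⟨-1, Or.inr rfl, fun x hx => ?_⟩
        rw [← pow_succ]
        linarith [h1 x hx]
    have hs1 : |s| = 1 := by rcases hs with rfl | rfl <;> simp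
    obtain ⟨p, q, hap, hpq, hqb, hlen, hleft, hright⟩ :=
      exists_splitting (g := fun x => s * g x) (hg.const_mul s) hab (pow_pos hμ (n + 1)) hμ
        ((convex_Icc a b).mul_sub_le_image_sub_of_le_deriv
          (hg.const_mul s).continuousOn
          (fun x _ => ((hgd x).const_mul s).differentiableAt.differentiableWithinAt)
          (fun x hx => by
            rw [((hgd x).const_mul s).deriv]
            exact hsg x (interior_subset hx)))
    have hsgn : ∀ u v, Set.Icc u v ⊆ Set.Icc a b → n = 0 → ∃ s : ℝ, |s| = 1 ∧
        ∀ x ∈ Set.Icc u v, 0 ≤ s * P.derivative.derivative.eval x := by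
      rintro u v huv rfl
      refine ⟨s, hs1, fun x hx => le_trans ?_ (hsg x (huv hx))⟩
      positivity
    have hc' : 0 ≤ c / μ := by positivity
    have i1 : ‖∫ x in a..p, eI (P.eval x)‖ ≤ c / μ := by
      rcases hleft with rfl | h
      · simpa using hc'
      refine ih P a p μ hap hμ ?_ (hsgn a p (Set.Icc_subset_Icc le_rfl (hpq.trans hqb)))
      rcases hs with rfl | rfl
      · exact Or.inr fun x hx => by simpa only [one_mul] using h x hx
      · exact Or.inl fun x hx => by
          have := h x hx
          simp only [hgdef] at this
          linarith
    have i2 : ‖∫ x in q..b, eI (P.eval x)‖ ≤ c / μ := by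
      rcases hright with rfl | h
      · simpa using hc'
      refine ih P q b μ hqb hμ ?_ (hsgn q b (Set.Icc_subset_Icc (hap.trans hpq) le_rfl))
      rcases hs with rfl | rfl
      · exact Or.inl fun x hx => by simpa only [one_mul] using h x hx
      · exact Or.inr fun x hx => by
          have := h x hx
          simp only [hgdef] at this
          linarith
    have i3 : ‖∫ x in p..q, eI (P.eval x)‖ ≤ 2 / μ := by
      refine (intervalIntegral.norm_integral_le_of_norm_le_const (C := 1)
        fun x _ => (norm_eI _).le).trans ?_
      rwa [one_mul, abs_of_nonneg (sub_nonneg.2 hpq)]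
    have hi : ∀ u v, IntervalIntegrable (fun x => eI (P.eval x)) volume u v :=
      (continuous_eI_polynomial P).intervalIntegrable
    rw [← intervalIntegral.integral_add_adjacent_intervals (hi a p) (hi p b),
      ← intervalIntegral.integral_add_adjacent_intervals (hi p q) (hi q b)]
    calc _ ≤ c / μ + (2 / μ + c / μ) :=
          (norm_add_le _ _).trans (add_le_add i1 ((norm_add_le _ _).trans (add_le_add i3 i2)))
      _ = _ := by ring

/-- The size, smoothness and (sharp cutoff) cancellation conditions on the kernel which enter the
oscillatory estimate. -/
structure IsSharpCZ (A : ℝ) (k : ℝ → ℂ) : Prop where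
  contDiff : ContDiff ℝ 1 k
  map_zero : k 0 = 0
  norm_le : ∀ t, t ≠ 0 → ‖k t‖ ≤ A / |t|
  norm_deriv_le : ∀ t, t ≠ 0 → ‖deriv k t‖ ≤ A / t ^ 2
  cancel : ∀ r, 0 < r → ‖∫ t in -r..r, k t‖ ≤ A

lemma IsSharpCZ.nonneg {A : ℝ} {k : ℝ → ℂ} (hk : IsSharpCZ A k) : 0 ≤ A :=
  (norm_nonneg _).trans (hk.cancel 1 one_pos)

/-- Integrals of `e^{iP} k` away from the origin, given a bound for the integrals of `e^{iP}`. -/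
lemma IsSharpCZ.norm_integral_le_of_oscillation {A : ℝ} {k : ℝ → ℂ} (hk : IsSharpCZ A k)
    (P : Polynomial ℝ) {a b R M : ℝ} (hR : 0 < R) (hab : a ≤ b) (h : R ≤ a ∨ b ≤ -R)
    (hM : ∀ t ∈ Set.Icc a b, ‖∫ x in a..t, eI (P.eval x)‖ ≤ M * R) :
    ‖∫ t in a..b, eI (P.eval t) * k t‖ ≤ 3 * M * A := by
  have hA := hk.nonneg
  have hc := continuous_eI_polynomial P
  have hfar : ∀ t ∈ Set.Icc a b, R ≤ |t| := fun t ht => by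
    rcases h with h | h
    · exact (h.trans ht.1).trans (le_abs_self t)
    · exact (le_neg.1 (ht.2.trans h)).trans (neg_le_abs t)
  have hne : ∀ t ∈ Set.Icc a b, t ≠ 0 := fun t ht => abs_pos.1 (hR.trans_le (hfar t ht))
  have key := norm_integral_deriv_mul_le hab
    (U := fun t => ∫ x in a..t, eI (P.eval x)) (U' := fun t => eI (P.eval t))
    (V := k) (V' := deriv k) (W := fun t => -A * t⁻¹) (W' := fun t => -A * -(t ^ 2)⁻¹)
    (fun x _ => intervalIntegral.integral_hasDerivAt_right (hc.intervalIntegrable _ _)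
      hc.stronglyMeasurable.stronglyMeasurableAtFilter hc.continuousAt)
    (fun x _ => (hk.contDiff.differentiable one_ne_zero x).hasDerivAt)
    (fun x hx => (hasDerivAt_inv (hne x hx)).const_mul (-A))
    hc.continuousOn (hk.contDiff.continuous_deriv le_rfl).continuousOn
    (continuousOn_const.mul (ContinuousOn.neg (ContinuousOn.inv₀ (by fun_prop)
      fun x hx => pow_ne_zero 2 (hne x hx))))
    hM (fun x hx => by
      rw [neg_mul_neg, ← div_eq_mul_inv]
      exact hk.norm_deriv_le x (hne x hx))
  have ha : a ∈ Set.Icc a b := ⟨le_rfl, hab⟩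
  have hb : b ∈ Set.Icc a b := ⟨hab, le_rfl⟩
  have hMR : 0 ≤ M * R := (norm_nonneg _).trans (hM a ha)
  have hk1 : ∀ t ∈ Set.Icc a b, ‖k t‖ ≤ A / R := fun t ht =>
    (hk.norm_le t (hne t ht)).trans (div_le_div_of_nonneg_left hA hR (hfar t ht))
  have hW : -A * b⁻¹ - -A * a⁻¹ ≤ A / R := by
    have : a⁻¹ - b⁻¹ ≤ R⁻¹ := by
      rcases h with h | h
      · have h1 : 0 ≤ b⁻¹ := inv_nonneg.2 (hR.le.trans (h.trans hab))
        have h2 := inv_anti₀ hR h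
        linarith
      · have h1 : a⁻¹ ≤ 0 := inv_nonpos.2 (by linarith)
        have h2 := inv_anti₀ hR (le_neg.1 h)
        rw [inv_neg] at h2
        linarith
    calc -A * b⁻¹ - -A * a⁻¹ = A * (a⁻¹ - b⁻¹) := by ring
      _ ≤ A * R⁻¹ := mul_le_mul_of_nonneg_left this hA
      _ = A / R := rfl
  refine key.trans ?_
  calc _ ≤ M * R * (A / R + A / R + A / R) := by
        gcongr
        exacts [hk1 b hb, hk1 a ha]
    _ = 3 * M * A := by field_simp; ring

/-- Replacing `Q` by `Q + a t ^ (d + 1)` costs little on `|t| ≤ r` as long as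
`|a| r ^ (d + 1) ≤ 1`. -/
lemma IsSharpCZ.norm_integral_sub_le {A : ℝ} {k : ℝ → ℂ} (hk : IsSharpCZ A k)
    (P Q : Polynomial ℝ) {a r : ℝ} {d : ℕ} (hr : 0 < r) (har : |a| * r ^ (d + 1) ≤ 1)
    (hPQ : ∀ t, P.eval t = a * t ^ (d + 1) + Q.eval t) :
    ‖(∫ t in -r..r, eI (P.eval t) * k t) - ∫ t in -r..r, eI (Q.eval t) * k t‖ ≤ 2 * A := by
  have hA := hk.nonneg
  have hi : ∀ P : Polynomial ℝ,
      IntervalIntegrable (fun t => eI (P.eval t) * k t) volume (-r) r := fun P =>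
    ((continuous_eI_polynomial P).mul hk.contDiff.continuous).intervalIntegrable _ _
  rw [← intervalIntegral.integral_sub (hi P) (hi Q)]
  refine (intervalIntegral.norm_integral_le_of_norm_le_const (C := A / r) fun t ht => ?_).trans ?_
  · rw [Set.uIoc_of_le (by linarith)] at ht
    rw [← sub_mul, norm_mul]
    rcases eq_or_ne t 0 with rfl | h0
    · rw [hk.map_zero, norm_zero, mul_zero]
      positivity
    have ht' : |t| ≤ r := abs_le.2 ⟨ht.1.le, ht.2⟩
    have ht0 : 0 < |t| := abs_pos.2 h0
    calc ‖eI (P.eval t) - eI (Q.eval t)‖ * ‖k t‖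
        ≤ |a * t ^ (d + 1)| * (A / |t|) := by
          rw [hPQ]
          exact mul_le_mul (norm_eI_add_sub_le _ _) (hk.norm_le t h0) (norm_nonneg _)
            (abs_nonneg _)
      _ = |a| * |t| ^ d * A := by
          rw [abs_mul, abs_pow, pow_succ]
          field_simp
      _ ≤ |a| * r ^ d * A := by gcongr
      _ = |a| * r ^ (d + 1) * (A / r) := by
          rw [pow_succ]
          field_simp
      _ ≤ A / r := mul_le_of_le_one_left (by positivity) har
  · rw [abs_of_nonneg (show 0 ≤ r - -r by linarith)]
    apply le_of_eq
    field_simp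
    ring

/-- A polynomial of degree at most `n` has constant `n`-th derivative. -/
lemma iterate_derivative_eval_of_natDegree_le {P : Polynomial ℝ} {n : ℕ} (h : P.natDegree ≤ n)
    (x : ℝ) : (Polynomial.derivative^[n] P).eval x = n.factorial * P.coeff n := by
  have hdeg : (Polynomial.derivative^[n] P).natDegree = 0 :=
    Nat.le_zero.1 ((P.natDegree_iterate_derivative n).trans (by omega))
  rw [Polynomial.eq_C_of_natDegree_eq_zero hdeg, Polynomial.eval_C,
    Polynomial.coeff_iterate_derivative, zero_add, Nat.descFactorial_self, nsmul_eq_mul]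

/-- Van der Corput's lemma for the top order derivative of a polynomial. -/
lemma exists_van_der_Corput_leadingCoeff (n : ℕ) : ∃ c : ℝ, 0 ≤ c ∧
    ∀ (P : Polynomial ℝ) (a b μ : ℝ), P.natDegree ≤ n + 1 → a ≤ b → 0 < μ →
      μ ^ (n + 1) = |P.coeff (n + 1)| → ‖∫ x in a..b, eI (P.eval x)‖ ≤ c / μ := by
  obtain ⟨c, hc, h⟩ := exists_van_der_Corput n
  refine ⟨c, hc, fun P a b μ hP hab hμ hcoeff => h P a b μ hab hμ ?_ ?_⟩
  · have hfac : (1 : ℝ) ≤ (n + 1).factorial := by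
      exact_mod_cast (n + 1).factorial_pos
    simp only [iterate_derivative_eval_of_natDegree_le hP, hcoeff]
    rcases le_total 0 (P.coeff (n + 1)) with h0 | h0
    · left
      intro x _
      rw [abs_of_nonneg h0]
      exact le_mul_of_one_le_left h0 hfac
    · right
      intro x _
      rw [abs_of_nonpos h0, neg_neg]
      nlinarith
  · rintro rfl
    refine ⟨1, abs_one, fun x _ => ?_⟩
    have := iterate_derivative_eval_of_natDegree_le (hP.trans (Nat.le_succ 1)) x
    have hz : P.coeff 2 = 0 := Polynomial.coeff_eq_zero_of_natDegree_lt (by omega)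
    simp [hz] at this
    simp [this]

/-- The oscillatory estimate for kernels satisfying the sharp cutoff cancellation condition. -/
lemma exists_bound_integral_eI_mul (d : ℕ) : ∃ B : ℝ, ∀ (A : ℝ) (k : ℝ → ℂ), IsSharpCZ A k →
    ∀ (P : Polynomial ℝ) (r : ℝ), P.natDegree ≤ d → 0 < r →
      ‖∫ t in -r..r, eI (P.eval t) * k t‖ ≤ B * A := by
  induction d with
  | zero =>
    refine ⟨1, fun A k hk P r hP hr => ?_⟩
    rw [Polynomial.eq_C_of_natDegree_eq_zero (Nat.le_zero.1 hP)]
    simp only [Polynomial.eval_C]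
    rw [intervalIntegral.integral_const_mul, norm_mul, norm_eI, one_mul, one_mul]
    exact hk.cancel r hr
  | succ d ih =>
    obtain ⟨B, ih⟩ := ih
    obtain ⟨c, hc, hvdc⟩ := exists_van_der_Corput_leadingCoeff d
    refine ⟨B + 2 + 6 * c, fun A k hk P r hP hr => ?_⟩
    have hA := hk.nonneg
    set a := P.coeff (d + 1) with ha
    set Q := P.erase (d + 1) with hQ
    have hPQ : ∀ t, P.eval t = a * t ^ (d + 1) + Q.eval t := fun t => by
      conv_lhs => rw [← P.monomial_add_erase (d + 1)]
      simp [ha, hQ]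
    have hQdeg : Q.natDegree ≤ d := by
      rw [Polynomial.natDegree_le_iff_coeff_eq_zero]
      intro m hm
      rw [hQ, Polynomial.coeff_erase]
      split_ifs with h
      · rfl
      · exact Polynomial.coeff_eq_zero_of_natDegree_lt (by omega)
    have near : ∀ r, 0 < r → |a| * r ^ (d + 1) ≤ 1 →
        ‖∫ t in -r..r, eI (P.eval t) * k t‖ ≤ (B + 2) * A := fun r hr har => by
      have h1 := hk.norm_integral_sub_le P Q hr har hPQ
      have h2 := ih A k hk Q r hQdeg hr
      have h3 := norm_le_norm_sub_add (∫ t in -r..r, eI (P.eval t) * k t)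
        (∫ t in -r..r, eI (Q.eval t) * k t)
      linarith
    have hcA : 0 ≤ c * A := mul_nonneg hc hA
    rcases le_total (|a| * r ^ (d + 1)) 1 with har | har
    · have := near r hr har
      linarith
    have ha0 : 0 < |a| := by
      by_contra h
      have : |a| = 0 := le_antisymm (not_lt.1 h) (abs_nonneg a)
      rw [this, zero_mul] at har
      linarith
    obtain ⟨μ, hμ, hμa⟩ : ∃ μ : ℝ, 0 < μ ∧ μ ^ (d + 1) = |a| :=
      ⟨|a| ^ (((d + 1 : ℕ) : ℝ)⁻¹), Real.rpow_pos_of_pos ha0 _,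
        Real.rpow_inv_natCast_pow ha0.le (Nat.succ_ne_zero d)⟩
    have hR : 0 < μ⁻¹ := inv_pos.2 hμ
    have hRr : μ⁻¹ ≤ r := by
      rw [← hμa, ← mul_pow] at har
      have : 1 ≤ μ * r := by
        by_contra! h
        exact absurd har (not_le.2 (pow_lt_one₀ (by positivity) h (Nat.succ_ne_zero d)))
      rwa [inv_le_iff_one_le_mul₀ hμ, mul_comm]
    have hnear := near μ⁻¹ hR (by
      rw [← hμa, ← mul_pow, mul_inv_cancel₀ hμ.ne', one_pow])
    have osc : ∀ u v, u ≤ v → ‖∫ x in u..v, eI (P.eval x)‖ ≤ c * μ⁻¹ := fun u v huv =>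
      hvdc P u v μ hP huv hμ hμa
    have hright := hk.norm_integral_le_of_oscillation P hR hRr (Or.inl le_rfl)
      (fun t ht => osc _ t ht.1)
    have hleft := hk.norm_integral_le_of_oscillation P hR (neg_le_neg hRr) (Or.inr le_rfl)
      (fun t ht => osc _ t ht.1)
    have hi : ∀ u v, IntervalIntegrable (fun t => eI (P.eval t) * k t) volume u v :=
      ((continuous_eI_polynomial P).mul hk.contDiff.continuous).intervalIntegrable
    rw [← intervalIntegral.integral_add_adjacent_intervals (hi (-r) (-μ⁻¹)) (hi (-μ⁻¹) r),
      ← intervalIntegral.integral_add_adjacent_intervals (hi (-μ⁻¹) μ⁻¹) (hi μ⁻¹ r)]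
    calc _ ≤ 3 * c * A + ((B + 2) * A + 3 * c * A) :=
          (norm_add_le _ _).trans
            (add_le_add hleft ((norm_add_le _ _).trans (add_le_add hnear hright)))
      _ = _ := by ring

/-- There is a normalized bump function which is a positive constant on `[-1/2, 1/2]`. -/
lemma exists_isNormalizedBump_eq_const : ∃ φ : ℝ → ℝ, IsNormalizedBump φ ∧
    ∃ m : ℝ, 0 < m ∧ (∀ t, 1 ≤ |t| → φ t = 0) ∧ (∀ t, |t| ≤ 1 / 2 → φ t = m) ∧
      ∀ t, 0 ≤ φ t ∧ φ t ≤ m := by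
  let f : ContDiffBump (0 : ℝ) := ⟨1 / 2, 1, by norm_num, by norm_num⟩
  have hf : ContDiff ℝ (⊤ : ℕ∞) f := f.contDiff
  obtain ⟨K, hK⟩ := f.hasCompactSupport.deriv.exists_bound_of_continuous
    (hf.continuous_deriv (by simp))
  have hK0 : 0 ≤ K := (norm_nonneg _).trans (hK 0)
  have hm0 : 0 < (K + 1)⁻¹ := by positivity
  have hm1 : (K + 1)⁻¹ ≤ 1 := inv_le_one_of_one_le₀ (by linarith)
  have hzero : ∀ t : ℝ, 1 ≤ |t| → (K + 1)⁻¹ * f t = 0 := fun t ht => by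
    rw [f.zero_of_le_dist (by rw [dist_zero_right]; exact ht), mul_zero]
  refine ⟨fun t => (K + 1)⁻¹ * f t, ⟨contDiff_const.mul hf, fun t ht => hzero t ht.le, fun t => ?_,
    fun t => ?_⟩, (K + 1)⁻¹, hm0, hzero, fun t ht => ?_, fun t => ⟨?_, ?_⟩⟩
  · rw [abs_mul, abs_of_pos hm0, abs_of_nonneg f.nonneg]
    exact mul_le_one₀ hm1 f.nonneg f.le_one
  · rw [deriv_const_mul _ (hf.differentiable (by simp) t), abs_mul, abs_of_pos hm0,
      inv_mul_le_iff₀ (by positivity), mul_one]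
    exact (hK t).trans (by linarith)
  · change (K + 1)⁻¹ * f t = (K + 1)⁻¹
    rw [f.one_of_mem_closedBall (by simpa [f] using ht), mul_one]
  · exact mul_nonneg hm0.le f.nonneg
  · exact mul_le_of_le_one_right hm0.le f.le_one

/-- Truncated Calderón–Zygmund kernels satisfy the sharp cutoff conditions, with a constant
depending only on the kernel constants. -/
lemma exists_isSharpCZ (Cd : ℕ → ℝ) (C : ℝ) : ∃ A : ℝ, ∀ ε N : ℝ, 0 < ε → ∀ k : ℝ → ℂ,
    IsTruncCZ Cd C ε N k → IsSharpCZ A k := by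
  obtain ⟨φ, hφ, m, hm, hφ0, hφm, hφb⟩ := exists_isNormalizedBump_eq_const
  refine ⟨|Cd 0| + |Cd 1| + (m⁻¹ * |C| + 4 * |Cd 0|), fun ε N hε k hk => ?_⟩
  obtain ⟨hsmooth, hsupp, hdecay, hcancel⟩ := hk
  have hmC : 0 ≤ m⁻¹ * |C| := by positivity
  have hk0 : k 0 = 0 := hsupp 0 fun h => by
    rw [abs_zero] at h
    linarith [h.1]
  have hsize : ∀ t, t ≠ 0 → ‖k t‖ ≤ |Cd 0| / |t| := fun t ht => by
    have h := hdecay 0 t ht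
    rw [iteratedDeriv_zero, Nat.cast_zero, sub_zero, Real.rpow_neg_one] at h
    exact h.trans (mul_le_mul_of_nonneg_right (le_abs_self _) (by positivity))
  refine ⟨hsmooth.of_le (by simp), hk0, fun t ht => ?_, fun t ht => ?_, fun r hr => ?_⟩
  · refine (hsize t ht).trans ?_
    gcongr
    linarith [abs_nonneg (Cd 0), abs_nonneg (Cd 1)]
  · have h := hdecay 1 t ht
    have he : |t| ^ (-1 - ((1 : ℕ) : ℝ)) = (t ^ 2)⁻¹ := by
      rw [show (-1 - ((1 : ℕ) : ℝ)) = -((2 : ℕ) : ℝ) by norm_num,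
        Real.rpow_neg (abs_nonneg t), Real.rpow_natCast, sq_abs]
    rw [iteratedDeriv_one, he] at h
    refine h.trans (mul_le_mul_of_nonneg_right ?_ (by positivity))
    linarith [le_abs_self (Cd 1), abs_nonneg (Cd 0)]
  · have hkc : Continuous k := hsmooth.continuous
    have hψc : Continuous fun t => (φ (r⁻¹ * t) : ℂ) :=
      Complex.continuous_ofReal.comp (hφ.1.continuous.comp (continuous_const.mul continuous_id))
    have hloc : ∫ t in -r..r, k t * (φ (r⁻¹ * t) : ℂ) = ∫ t, k t * (φ (r⁻¹ * t) : ℂ) := by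
      apply intervalIntegral.integral_eq_integral_of_support_subset
      intro t ht
      by_contra hnot
      have hle : r ≤ |t| := by
        by_contra! hlt
        exact hnot ⟨(abs_lt.1 hlt).1, (abs_lt.1 hlt).2.le⟩
      apply ht
      have hone : 1 ≤ |r⁻¹ * t| := by
        rw [abs_mul, abs_of_pos (inv_pos.2 hr), inv_mul_eq_div, one_le_div hr]
        exact hle
      simp [hφ0 _ hone]
    have hsplit : ∫ t in -r..r, k t = (m : ℂ)⁻¹ * (∫ t in -r..r, k t * (φ (r⁻¹ * t) : ℂ)) +
        ∫ t in -r..r, k t * (1 - (m : ℂ)⁻¹ * (φ (r⁻¹ * t) : ℂ)) := by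
      rw [← intervalIntegral.integral_const_mul, ← intervalIntegral.integral_add]
      · congr 1
        ext t
        ring
      · exact (continuous_const.mul (hkc.mul hψc)).intervalIntegrable _ _
      · exact (hkc.mul (continuous_const.sub (continuous_const.mul hψc))).intervalIntegrable _ _
    have h1 : ‖(m : ℂ)⁻¹ * (∫ t in -r..r, k t * (φ (r⁻¹ * t) : ℂ))‖ ≤ m⁻¹ * |C| := by
      rw [norm_mul, norm_inv, Complex.norm_real, Real.norm_of_nonneg hm.le, hloc]
      gcongr
      exact (hcancel r⁻¹ (inv_pos.2 hr) φ hφ).trans (le_abs_self C)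
    have h2 : ‖∫ t in -r..r, k t * (1 - (m : ℂ)⁻¹ * (φ (r⁻¹ * t) : ℂ))‖ ≤ 4 * |Cd 0| := by
      refine (intervalIntegral.norm_integral_le_of_norm_le_const (C := 2 * |Cd 0| / r)
        fun t _ => ?_).trans ?_
      · rcases le_total |r⁻¹ * t| (1 / 2) with hs | hs
        · rw [hφm _ hs, inv_mul_cancel₀ (Complex.ofReal_ne_zero.2 hm.ne'), sub_self, mul_zero,
            norm_zero]
          positivity
        · rw [abs_mul, abs_of_pos (inv_pos.2 hr), inv_mul_eq_div, div_le_div_iff₀ two_pos hr]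
            at hs
          have ht0 : 0 < |t| := by linarith
          have hw : ‖1 - (m : ℂ)⁻¹ * (φ (r⁻¹ * t) : ℂ)‖ ≤ 1 := by
            have : 1 - (m : ℂ)⁻¹ * (φ (r⁻¹ * t) : ℂ)
                = ((1 - m⁻¹ * φ (r⁻¹ * t) : ℝ) : ℂ) := by push_cast; rfl
            rw [this, Complex.norm_real, Real.norm_eq_abs, abs_le]
            obtain ⟨hb0, hb1⟩ := hφb (r⁻¹ * t)
            have hl : 0 ≤ m⁻¹ * φ (r⁻¹ * t) := by positivity
            have hu : m⁻¹ * φ (r⁻¹ * t) ≤ 1 := by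
              rw [inv_mul_le_iff₀ hm, mul_one]
              exact hb1
            constructor <;> linarith
          rw [norm_mul]
          calc _ ≤ |Cd 0| / |t| * 1 :=
                mul_le_mul (hsize t (abs_pos.1 ht0)) hw (norm_nonneg _) (by positivity)
            _ ≤ 2 * |Cd 0| / r := by
                rw [mul_one, div_le_div_iff₀ ht0 hr]
                nlinarith [abs_nonneg (Cd 0)]
      · rw [abs_of_nonneg (show 0 ≤ r - -r by linarith)]
        apply le_of_eq
        field_simp
        ring
    rw [hsplit]
    refine (norm_add_le _ _).trans ((add_le_add h1 h2).trans ?_)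
    linarith [abs_nonneg (Cd 0), abs_nonneg (Cd 1)]

/-- Oscillatory integral estimate for truncated CZ kernels against
`e^{iP(t)}` with `P` a real polynomial of degree at most `d`: the bound depends only
on `d` and the CZ constants, not on the truncations `ε, N` or the coefficients of `P`. -/
theorem oscillatory_polynomial_CZ_bound (d : ℕ) (Cd : ℕ → ℝ) (C : ℝ) :
    ∃ c : ℝ, ∀ ε N : ℝ, 0 < ε → ε < N →
      ∀ k : ℝ → ℂ, IsTruncCZ Cd C ε N k →
        ∀ P : Polynomial ℝ, P.natDegree ≤ d →
          ‖∫ t : ℝ, eI (P.eval t) * k t‖ ≤ c := by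
  obtain ⟨A, hA⟩ := exists_isSharpCZ Cd C
  obtain ⟨B, hB⟩ := exists_bound_integral_eI_mul d
  refine ⟨B * A, fun ε N hε hN k hk P hP => ?_⟩
  have hpos : 0 < N + 1 := by linarith
  have h := hB A k (hA ε N hε k hk) P (N + 1) hP hpos
  rwa [intervalIntegral.integral_eq_integral_of_support_subset] at h
  intro t ht
  by_contra hnot
  apply ht
  have hkt : k t = 0 := hk.2.1 t fun hmem => hnot <| by
    have := abs_le.1 hmem.2
    constructor <;> linarith
  simp [hkt]
end
end

section
/- Let (k_j)_{j∈ℕ} be a sequence of smooth functions on ℝ such that k_j is supported in {t : ε_j ≤ |t| ≤ N_j} with ε_j → 0 and N_j → ∞, the k_j satisfy uniformly the truncated CZ kernel bounds with common constants ((C_α)_{α∈ℕ}, C), and k_j converges in the space of tempered distributions 𝓢'(ℝ). Define m_j(ξ,η) = ∫_ℝ e^{−2πi(tξ + t²η)} k_j(t) dt. Then for every (ξ,η) ∈ ℝ² with η ≠ 0 the limit m(ξ,η) = lim_{j→∞} m_j(ξ,η) exists, and the limit function m is C^∞ on the open set {(ξ,η) ∈ ℝ² : η ≠ 0}. -/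
open Real Filter Topology MeasureTheory ENNReal NNReal

noncomputable section

/-- The oscillatory integral `∫ e^{-2πi(tξ+t²η)} g(t) dt` as a function of `(ξ,η)`. -/
def oscInt (g : ℝ → ℂ) (p : ℝ × ℝ) : ℂ :=
  ∫ t : ℝ, eI (-2 * π * (t * p.1 + t ^ 2 * p.2)) * g t

lemma contDiff_eI : ContDiff ℝ (⊤ : ℕ∞) eI := by
  unfold eI
  exact (contDiff_const.mul Complex.ofRealCLM.contDiff).cexp

lemma contDiff_eI_phase (p : ℝ × ℝ) :
    ContDiff ℝ (⊤ : ℕ∞) (fun t : ℝ => eI (-2 * π * (t * p.1 + t ^ 2 * p.2))) :=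
  contDiff_eI.comp (by fun_prop)

lemma hasDerivAt_eI (r : ℝ) : HasDerivAt eI (Complex.I * eI r) r := by
  have h : HasDerivAt (fun s : ℝ => Complex.I * (s : ℂ)) Complex.I r := by
    simpa using (Complex.ofRealCLM.hasDerivAt (x := r)).const_mul Complex.I
  exact h.cexp.congr_deriv (mul_comm _ _)

lemma hasDerivAt_eI_phase (p : ℝ × ℝ) (t : ℝ) :
    HasDerivAt (fun t : ℝ => eI (-2 * π * (t * p.1 + t ^ 2 * p.2)))
      (-2 * π * Complex.I * (p.1 + 2 * t * p.2) * eI (-2 * π * (t * p.1 + t ^ 2 * p.2))) t := by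
  have h : HasDerivAt (fun t : ℝ => -2 * π * (t * p.1 + t ^ 2 * p.2))
      (-2 * π * (p.1 + 2 * t * p.2)) t := by
    have := (((hasDerivAt_id t).mul_const p.1).add
      (((hasDerivAt_id t).pow 2).mul_const p.2)).const_mul (-2 * π)
    simpa using this
  refine ((hasDerivAt_eI _).scomp t h).congr_deriv ?_
  rw [Complex.real_smul]
  push_cast
  ring

/-- The linear functional `(ξ,η) ↦ -2πiξ`. -/
def phaseFst : ℝ × ℝ →L[ℝ] ℂ :=
  (-2 * π * Complex.I) • Complex.ofRealCLM.comp (ContinuousLinearMap.fst ℝ ℝ ℝ)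

/-- The linear functional `(ξ,η) ↦ -2πiη`. -/
def phaseSnd : ℝ × ℝ →L[ℝ] ℂ :=
  (-2 * π * Complex.I) • Complex.ofRealCLM.comp (ContinuousLinearMap.snd ℝ ℝ ℝ)

lemma hasFDerivAt_eI_phase (t : ℝ) (p : ℝ × ℝ) :
    HasFDerivAt (fun p : ℝ × ℝ => eI (-2 * π * (t * p.1 + t ^ 2 * p.2)))
      (eI (-2 * π * (t * p.1 + t ^ 2 * p.2)) •
        ((t : ℂ) • phaseFst + ((t : ℂ) ^ 2) • phaseSnd)) p := by
  have h : HasFDerivAt (fun p : ℝ × ℝ => -2 * π * (t * p.1 + t ^ 2 * p.2))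
      ((-2 * π) • (t • ContinuousLinearMap.fst ℝ ℝ ℝ + t ^ 2 • ContinuousLinearMap.snd ℝ ℝ ℝ)) p :=
    ((hasFDerivAt_fst.const_mul t).add (hasFDerivAt_snd.const_mul (t ^ 2))).const_mul (-2 * π)
  refine ((hasDerivAt_eI _).hasFDerivAt.comp p h).congr_fderiv ?_
  ext <;> simp [phaseFst, phaseSnd] <;> ring

lemma integrable_mul_of_hasCompactSupport {f g : ℝ → ℂ} (hf : Continuous f) (hg : Continuous g)
    (hs : HasCompactSupport g) : Integrable (fun t => f t * g t) :=
  (hf.mul hg).integrable_of_hasCompactSupport hs.mul_left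

lemma hasFDerivAt_oscInt {g : ℝ → ℂ} (hg : Continuous g) (hs : HasCompactSupport g) (p : ℝ × ℝ) :
    HasFDerivAt (oscInt g)
      (oscInt (fun t => (t : ℂ) * g t) p • phaseFst +
        oscInt (fun t => (t : ℂ) ^ 2 * g t) p • phaseSnd) p := by
  have he (q : ℝ × ℝ) : Continuous fun t : ℝ => eI (-2 * π * (t * q.1 + t ^ 2 * q.2)) :=
    (contDiff_eI_phase q).continuous
  have h1 : Integrable fun t : ℝ => eI (-2 * π * (t * p.1 + t ^ 2 * p.2)) * ((t : ℂ) * g t) :=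
    integrable_mul_of_hasCompactSupport (he p) (by fun_prop) hs.mul_left
  have h2 : Integrable fun t : ℝ => eI (-2 * π * (t * p.1 + t ^ 2 * p.2)) * ((t : ℂ) ^ 2 * g t) :=
    integrable_mul_of_hasCompactSupport (he p) (by fun_prop) hs.mul_left
  have key := hasFDerivAt_integral_of_dominated_of_fderiv_le (𝕜 := ℝ) (μ := volume) (s := Set.univ)
    (F := fun (q : ℝ × ℝ) (t : ℝ) => eI (-2 * π * (t * q.1 + t ^ 2 * q.2)) * g t)
    (F' := fun q t => (eI (-2 * π * (t * q.1 + t ^ 2 * q.2)) * ((t : ℂ) * g t)) • phaseFst +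
      (eI (-2 * π * (t * q.1 + t ^ 2 * q.2)) * ((t : ℂ) ^ 2 * g t)) • phaseSnd)
    (bound := fun t => ‖(t : ℂ) * g t‖ * ‖phaseFst‖ + ‖(t : ℂ) ^ 2 * g t‖ * ‖phaseSnd‖)
    (x₀ := p) univ_mem ?_ ?_ ?_ ?_ ?_ ?_
  · refine key.congr_fderiv ?_
    rw [integral_add (h1.smul_const _) (h2.smul_const _), integral_smul_const,
      integral_smul_const]
    rfl
  · exact .of_forall fun q => ((he q).mul hg).aestronglyMeasurable
  · exact integrable_mul_of_hasCompactSupport (he p) hg hs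
  · exact ((h1.smul_const phaseFst).add (h2.smul_const phaseSnd)).aestronglyMeasurable
  · refine .of_forall fun t q _ => (norm_add_le _ _).trans ?_
    simp [norm_smul, norm_eI]
  · refine .add ?_ ?_
    · exact (integrable_mul_of_hasCompactSupport (by fun_prop) hg hs).norm.mul_const _
    · exact (integrable_mul_of_hasCompactSupport (by fun_prop) hg hs).norm.mul_const _
  · refine .of_forall fun t q _ => ?_
    refine ((hasFDerivAt_eI_phase t q).mul_const (g t)).congr_fderiv ?_
    ext <;> simp <;> ring

lemma oscInt_add {f g : ℝ → ℂ} (hf : Continuous f) (hfs : HasCompactSupport f)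
    (hg : Continuous g) (hgs : HasCompactSupport g) (p : ℝ × ℝ) :
    oscInt (fun t => f t + g t) p = oscInt f p + oscInt g p := by
  have he := (contDiff_eI_phase p).continuous
  unfold oscInt
  simp only [mul_add (eI _)]
  exact integral_add (integrable_mul_of_hasCompactSupport he hf hfs)
    (integrable_mul_of_hasCompactSupport he hg hgs)

lemma oscInt_const_mul (c : ℂ) (g : ℝ → ℂ) (p : ℝ × ℝ) :
    oscInt (fun t => c * g t) p = c * oscInt g p := by
  simp only [oscInt, mul_left_comm _ c, integral_const_mul]

/-- Integration by parts: the top moment is expressed through lower ones where `η ≠ 0`. -/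
lemma oscInt_mul_self {g g' : ℝ → ℂ} (hg : ∀ t, HasDerivAt g (g' t) t) (hg' : Continuous g')
    (hs : HasCompactSupport g) (hs' : HasCompactSupport g') {p : ℝ × ℝ} (hp : p.2 ≠ 0) :
    oscInt (fun t => (t : ℂ) * g t) p =
      (-(p.1 : ℂ) / (2 * p.2)) * oscInt g p +
        (1 / (4 * π * Complex.I * p.2)) * oscInt g' p := by
  have he := (contDiff_eI_phase p).continuous
  have hgc : Continuous g := continuous_iff_continuousAt.2 fun t => (hg t).continuousAt
  have i0 := integrable_mul_of_hasCompactSupport he hgc hs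
  have i1 : Integrable fun t : ℝ => eI (-2 * π * (t * p.1 + t ^ 2 * p.2)) * ((t : ℂ) * g t) :=
    integrable_mul_of_hasCompactSupport he (by fun_prop) hs.mul_left
  have i2 := integrable_mul_of_hasCompactSupport he hg' hs'
  have e (t : ℝ) : -2 * π * Complex.I * (p.1 + 2 * t * p.2) *
        eI (-2 * π * (t * p.1 + t ^ 2 * p.2)) * g t +
        eI (-2 * π * (t * p.1 + t ^ 2 * p.2)) * g' t =
      (-2 * π * Complex.I * p.1) * (eI (-2 * π * (t * p.1 + t ^ 2 * p.2)) * g t) +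
      (-4 * π * Complex.I * p.2) * (eI (-2 * π * (t * p.1 + t ^ 2 * p.2)) * ((t : ℂ) * g t)) +
        eI (-2 * π * (t * p.1 + t ^ 2 * p.2)) * g' t := by ring
  have h := integral_eq_zero_of_hasDerivAt_of_integrable
    (fun t => (hasDerivAt_eI_phase p t).mul (hg t))
    (by simp only [e]; exact ((i0.const_mul _).add (i1.const_mul _)).add i2) i0
  simp only [e] at h
  have i01 : Integrable fun t : ℝ =>
      (-2 * π * Complex.I * p.1) * (eI (-2 * π * (t * p.1 + t ^ 2 * p.2)) * g t) +
      (-4 * π * Complex.I * p.2) * (eI (-2 * π * (t * p.1 + t ^ 2 * p.2)) * ((t : ℂ) * g t)) :=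
    (i0.const_mul _).add (i1.const_mul _)
  rw [integral_add i01 i2, integral_add (i0.const_mul _) (i1.const_mul _), integral_const_mul,
    integral_const_mul] at h
  change _ * oscInt g p + _ * oscInt (fun t => (t : ℂ) * g t) p + oscInt g' p = 0 at h
  have hp' : (p.2 : ℂ) ≠ 0 := by exact_mod_cast hp
  have hpi : (π : ℂ) ≠ 0 := by exact_mod_cast Real.pi_ne_zero
  have hI := Complex.I_ne_zero
  field_simp
  linear_combination (-2 : ℂ) * h

/-- A sequence of functions which, at each point of `{η ≠ 0}`, converges and is locally bounded
uniformly in the index. -/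
def IsControlled (F : ℕ → ℝ × ℝ → ℂ) : Prop :=
  ∀ p : ℝ × ℝ, p.2 ≠ 0 → (∃ L, Tendsto (fun j => F j p) atTop (𝓝 L)) ∧
    ∃ B : ℝ, ∀ᶠ q in 𝓝 p, ∀ j, ‖F j q‖ ≤ B

lemma eventually_snd_ne_zero {p : ℝ × ℝ} (hp : p.2 ≠ 0) : ∀ᶠ q : ℝ × ℝ in 𝓝 p, q.2 ≠ 0 :=
  continuous_snd.continuousAt.eventually_ne hp

namespace IsControlled

variable {F G : ℕ → ℝ × ℝ → ℂ}

lemma add (hF : IsControlled F) (hG : IsControlled G) :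
    IsControlled (fun j p => F j p + G j p) := by
  intro p hp
  obtain ⟨⟨L, hL⟩, B, hB⟩ := hF p hp
  obtain ⟨⟨L', hL'⟩, B', hB'⟩ := hG p hp
  refine ⟨⟨_, hL.add hL'⟩, B + B', ?_⟩
  filter_upwards [hB, hB'] with q h h' j
  exact (norm_add_le _ _).trans (add_le_add (h j) (h' j))

lemma continuous_mul (hF : IsControlled F) {c : ℝ × ℝ → ℂ}
    (hc : ∀ p : ℝ × ℝ, p.2 ≠ 0 → ContinuousAt c p) :
    IsControlled (fun j p => c p * F j p) := by
  intro p hp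
  obtain ⟨⟨L, hL⟩, B, hB⟩ := hF p hp
  refine ⟨⟨_, hL.const_mul (c p)⟩, (‖c p‖ + 1) * B, ?_⟩
  filter_upwards [hB, (hc p hp).norm.eventually_lt_const (lt_add_one _)] with q h h' j
  rw [norm_mul]
  exact mul_le_mul h'.le (h j) (norm_nonneg _) (by positivity)

lemma congr (hF : IsControlled F) (h : ∀ j (p : ℝ × ℝ), p.2 ≠ 0 → G j p = F j p) :
    IsControlled G := by
  intro p hp
  obtain ⟨⟨L, hL⟩, B, hB⟩ := hF p hp
  refine ⟨⟨L, by simpa only [h _ p hp] using hL⟩, B, ?_⟩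
  filter_upwards [hB, eventually_snd_ne_zero hp] with q hq hq' j
  simpa only [h _ q hq'] using hq j

end IsControlled

/-- Convergence of a sequence of functions tested against smooth compactly supported functions. -/
def TestConvergent (f : ℕ → ℝ → ℂ) : Prop :=
  ∀ φ : ℝ → ℂ, ContDiff ℝ (⊤ : ℕ∞) φ → HasCompactSupport φ →
    ∃ L, Tendsto (fun j => ∫ t, f j t * φ t) atTop (𝓝 L)

lemma TestConvergent.mul_left {f : ℕ → ℝ → ℂ} (hf : TestConvergent f) {a : ℝ → ℂ}
    (ha : ContDiff ℝ (⊤ : ℕ∞) a) : TestConvergent (fun j t => a t * f j t) := by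
  intro φ hφ hs
  obtain ⟨L, hL⟩ := hf (fun t => a t * φ t) (ha.mul hφ) hs.mul_left
  exact ⟨L, by simpa only [mul_assoc, mul_left_comm] using hL⟩

lemma contDiff_deriv {f : ℝ → ℂ} (hf : ContDiff ℝ (⊤ : ℕ∞) f) :
    ContDiff ℝ (⊤ : ℕ∞) (deriv f) :=
  (contDiff_infty_iff_deriv.1 hf).2

lemma TestConvergent.deriv {f : ℕ → ℝ → ℂ} (hf : TestConvergent f)
    (hd : ∀ j, ContDiff ℝ (⊤ : ℕ∞) (f j)) : TestConvergent (fun j => deriv (f j)) := by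
  intro φ hφ hs
  obtain ⟨L, hL⟩ := hf (_root_.deriv φ) (contDiff_deriv hφ) hs.deriv
  refine ⟨-L, hL.neg.congr fun j => ?_⟩
  have hdiff {g : ℝ → ℂ} (hg : ContDiff ℝ (⊤ : ℕ∞) g) (t : ℝ) :
      HasDerivAt g (_root_.deriv g t) t :=
    (hg.differentiable (by simp)).differentiableAt.hasDerivAt
  have := integral_mul_deriv_eq_deriv_mul_of_integrable (u := f j) (v := φ)
    (fun t _ => hdiff (hd j) t) (fun t _ => hdiff hφ t)
    (integrable_mul_of_hasCompactSupport (hd j).continuous (contDiff_deriv hφ).continuous hs.deriv)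
    (integrable_mul_of_hasCompactSupport (contDiff_deriv (hd j)).continuous hφ.continuous hs)
    (integrable_mul_of_hasCompactSupport (hd j).continuous hφ.continuous hs)
  rw [this, neg_neg]

/-- A smooth cutoff equal to `1` on `[-r, r]`. -/
lemma exists_smooth_cutoff {r : ℝ} (hr : 0 < r) : ∃ ψ : ℝ → ℝ, ContDiff ℝ (⊤ : ℕ∞) ψ ∧
    HasCompactSupport ψ ∧ (∀ t, |t| ≤ r → ψ t = 1) ∧ ∀ t, 0 ≤ ψ t ∧ ψ t ≤ 1 := by
  let b : ContDiffBump (0 : ℝ) := ⟨r, r + 1, hr, by linarith⟩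
  exact ⟨b, b.contDiff, b.hasCompactSupport,
    fun t ht => b.one_of_mem_closedBall (by simpa using ht), fun t => ⟨b.nonneg, b.le_one⟩⟩

lemma exists_tendsto_of_approx {a : ℕ → ℂ}
    (h : ∀ ε > 0, ∃ b : ℕ → ℂ, (∃ L, Tendsto b atTop (𝓝 L)) ∧ ∀ j, ‖a j - b j‖ ≤ ε) :
    ∃ L, Tendsto a atTop (𝓝 L) := by
  refine cauchySeq_tendsto_of_complete (Metric.cauchySeq_iff'.2 fun ε hε => ?_)
  obtain ⟨b, ⟨L, hL⟩, hb⟩ := h (ε / 4) (by positivity)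
  obtain ⟨n₀, hn₀⟩ := Metric.cauchySeq_iff'.1 hL.cauchySeq (ε / 4) (by positivity)
  refine ⟨n₀, fun n hn => ?_⟩
  have h1 := hn₀ n hn
  have h2 := hb n
  have h3 := hb n₀
  rw [← dist_eq_norm] at h2 h3
  have := dist_triangle4 (a n) (b n) (b n₀) (a n₀)
  rw [dist_comm] at h3
  linarith

lemma TestConvergent.oscInt_tendsto {f : ℕ → ℝ → ℂ} (hf : TestConvergent f) {ψ : ℝ → ℂ}
    (hψ : ContDiff ℝ (⊤ : ℕ∞) ψ) (hs : HasCompactSupport ψ) (p : ℝ × ℝ) :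
    ∃ L, Tendsto (fun j => oscInt (fun t => ψ t * f j t) p) atTop (𝓝 L) := by
  obtain ⟨L, hL⟩ := hf _ ((contDiff_eI_phase p).mul hψ) hs.mul_left
  refine ⟨L, hL.congr fun j => integral_congr_ae (.of_forall fun t => ?_)⟩
  ring

lemma norm_oscInt_le {g : ℝ → ℂ} {b : ℝ → ℝ} (hb : Integrable b) (h : ∀ t, ‖g t‖ ≤ b t)
    (p : ℝ × ℝ) : ‖oscInt g p‖ ≤ ∫ t, b t :=
  norm_integral_le_of_norm_le hb (.of_forall fun t => by simpa [norm_eI] using h t)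

/-- Uniform integrable decay makes the oscillatory integrals of a test-convergent sequence
converge. -/
lemma isControlled_oscInt_of_decay {f : ℕ → ℝ → ℂ} (hc : ∀ j, Continuous (f j))
    (hs : ∀ j, HasCompactSupport (f j)) (hf : TestConvergent f) {C : ℝ}
    (hC : ∀ j t, ‖f j t‖ ≤ C * (1 + t ^ 2)⁻¹) : IsControlled (fun j => oscInt (f j)) := by
  have hbI : Integrable fun t : ℝ => C * (1 + t ^ 2)⁻¹ := integrable_inv_one_add_sq.const_mul C
  refine fun p _ => ⟨exists_tendsto_of_approx fun ε hε => ?_, _,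
    .of_forall fun q j => norm_oscInt_le hbI (hC j) q⟩
  choose ψ hψ hψs hψ1 hψb using fun n : ℕ => exists_smooth_cutoff (r := n + 1) (by positivity)
  have htail : Tendsto (fun n => ∫ t : ℝ, (1 - ψ n t) * (C * (1 + t ^ 2)⁻¹)) atTop (𝓝 0) := by
    rw [← integral_zero ℝ ℝ (μ := volume)]
    refine tendsto_integral_of_dominated_convergence (fun t => ‖C * (1 + t ^ 2)⁻¹‖)
      (fun n => ?_) hbI.norm (fun n => .of_forall fun t => ?_) (.of_forall fun t => ?_)
    · exact ((continuous_const.sub (hψ n).continuous).aestronglyMeasurable).mul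
        hbI.aestronglyMeasurable
    · rw [norm_mul]
      refine mul_le_of_le_one_left (norm_nonneg _) ?_
      rw [Real.norm_eq_abs, abs_le]
      constructor <;> linarith [(hψb n t).1, (hψb n t).2]
    · refine tendsto_const_nhds.congr' ?_
      filter_upwards [eventually_ge_atTop ⌈|t|⌉₊] with n hn
      rw [hψ1 n t ((Nat.ceil_le.1 hn).trans (by linarith)), sub_self, zero_mul]
  obtain ⟨n, hn⟩ := (htail.eventually_lt_const hε).exists
  have hψc : ContDiff ℝ (⊤ : ℕ∞) fun t => (ψ n t : ℂ) := Complex.ofRealCLM.contDiff.comp (hψ n)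
  refine ⟨fun j => oscInt (fun t => (ψ n t : ℂ) * f j t) p,
    hf.oscInt_tendsto hψc ((hψs n).comp_left Complex.ofReal_zero) p, fun j => ?_⟩
  have hsub : oscInt (f j) p - oscInt (fun t => (ψ n t : ℂ) * f j t) p =
      oscInt (fun t => (1 - ψ n t : ℂ) * f j t) p := by
    have hadd := oscInt_add (f := fun t => (1 - ψ n t : ℂ) * f j t)
      (g := fun t => (ψ n t : ℂ) * f j t) (by have := hψc.continuous; have := hc j; fun_prop)
      (hs j).mul_left (hψc.continuous.mul (hc j)) (hs j).mul_left p
    simp only [← add_mul, sub_add_cancel, one_mul] at hadd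
    exact sub_eq_of_eq_add hadd
  rw [hsub]
  refine (norm_oscInt_le (b := fun t => (1 - ψ n t) * (C * (1 + t ^ 2)⁻¹)) ?_ (fun t => ?_) p).trans
    hn.le
  · refine hbI.bdd_mul (c := 1) (continuous_const.sub (hψ n).continuous).aestronglyMeasurable
      (.of_forall fun t => ?_)
    rw [Real.norm_eq_abs, abs_le]
    constructor <;> linarith [(hψb n t).1, (hψb n t).2]
  · rw [norm_mul]
    have h0 : 0 ≤ 1 - ψ n t := by linarith [(hψb n t).2]
    have : ‖(1 - ψ n t : ℂ)‖ = 1 - ψ n t := by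
      rw [← Complex.ofReal_one, ← Complex.ofReal_sub, Complex.norm_of_nonneg h0]
    rw [this]
    exact mul_le_mul_of_nonneg_left (hC j t) h0

/-- A test-convergent sequence of smooth compactly supported functions all of whose derivatives
decay like `(1 + t²)⁻¹`, uniformly in the index. -/
structure IsDecaying (f : ℕ → ℝ → ℂ) : Prop where
  contDiff : ∀ j, ContDiff ℝ (⊤ : ℕ∞) (f j)
  hasCompactSupport : ∀ j, HasCompactSupport (f j)
  testConvergent : TestConvergent f
  decay : ∀ α : ℕ, ∃ C : ℝ, ∀ j t, ‖iteratedDeriv α (f j) t‖ ≤ C * (1 + t ^ 2)⁻¹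

namespace IsDecaying

variable {f : ℕ → ℝ → ℂ}

lemma deriv (hf : IsDecaying f) : IsDecaying (fun j => deriv (f j)) where
  contDiff j := contDiff_deriv (hf.contDiff j)
  hasCompactSupport j := (hf.hasCompactSupport j).deriv
  testConvergent := hf.testConvergent.deriv hf.contDiff
  decay α := by simpa only [← iteratedDeriv_succ'] using hf.decay (α + 1)

lemma isControlled_oscInt_pow_mul (n : ℕ) : ∀ {f : ℕ → ℝ → ℂ}, IsDecaying f →
    IsControlled (fun j => oscInt (fun t => (t : ℂ) ^ n * f j t)) := by
  induction n using Nat.strong_induction_on with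
  | _ n ih =>
    intro f hf
    rcases n with _ | n
    · obtain ⟨C, hC⟩ := hf.decay 0
      simpa using isControlled_oscInt_of_decay (fun j => (hf.contDiff j).continuous)
        hf.hasCompactSupport hf.testConvergent (by simpa using hC)
    · have hcont j : Continuous (f j) := (hf.contDiff j).continuous
      have hcont' j : Continuous (_root_.deriv (f j)) := (contDiff_deriv (hf.contDiff j)).continuous
      have h1 : IsControlled (fun j p => oscInt (fun t => (t : ℂ) ^ n * f j t) p) :=
        ih n (by lia) hf
      have h2 : IsControlled (fun j p => (n : ℂ) * oscInt (fun t => (t : ℂ) ^ (n - 1) * f j t) p) :=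
        (ih (n - 1) (by lia) hf).continuous_mul fun _ _ => continuousAt_const
      have h3 : IsControlled
          (fun j p => oscInt (fun t => (t : ℂ) ^ n * _root_.deriv (f j) t) p) :=
        ih n (by lia) hf.deriv
      refine ((h1.continuous_mul (c := fun p => -(p.1 : ℂ) / (2 * p.2)) fun p hp => ?_).add
        ((h2.add h3).continuous_mul (c := fun p => 1 / (4 * π * Complex.I * p.2))
          fun p hp => ?_)).congr fun j p hp => ?_
      · have : (2 * p.2 : ℂ) ≠ 0 := by simpa using hp
        fun_prop (disch := assumption)
      · have : (4 * π * Complex.I * p.2 : ℂ) ≠ 0 := by simpa [Real.pi_ne_zero] using hp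
        fun_prop (disch := assumption)
      · rw [← oscInt_const_mul (n : ℂ), ← oscInt_add, ← oscInt_mul_self _ _ _ _ hp]
        · simp only [pow_succ', mul_assoc]
        · intro t
          have := ((hasDerivAt_id t).ofReal_comp.pow n).mul
            ((hf.contDiff j).differentiable (by simp) t).hasDerivAt
          refine this.congr_deriv ?_
          simp [mul_assoc]
        · have := hcont j; have := hcont' j; fun_prop
        · exact (hf.hasCompactSupport j).mul_left
        · exact (hf.hasCompactSupport j).mul_left.mul_left.add
            (hf.deriv.hasCompactSupport j).mul_left
        · have := hcont j; fun_prop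
        · exact (hf.hasCompactSupport j).mul_left.mul_left
        · have := hcont' j; fun_prop
        · exact (hf.deriv.hasCompactSupport j).mul_left

end IsDecaying

section SmoothLimit

variable {F : ℕ → ℕ → ℝ × ℝ → ℂ} {M : ℕ → ℝ × ℝ → ℂ} {X Y : ℝ × ℝ →L[ℝ] ℂ}

lemma norm_smul_add_smul_le (a b : ℂ) {B : ℝ} (ha : ‖a‖ ≤ B) (hb : ‖b‖ ≤ B) :
    ‖a • X + b • Y‖ ≤ B * (‖X‖ + ‖Y‖) := by
  refine (norm_add_le _ _).trans ?_
  rw [norm_smul, norm_smul, mul_add]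
  gcongr

/-- If each derivative of `F n j` is built from `F (n+1) j` and `F (n+2) j`, and these are locally
bounded uniformly in `j`, the pointwise limit is differentiable with the limit derivative. -/
lemma hasFDerivAt_limit
    (hF : ∀ n j p, HasFDerivAt (F n j) (F (n + 1) j p • X + F (n + 2) j p • Y) p)
    (hM : ∀ n (p : ℝ × ℝ), p.2 ≠ 0 → Tendsto (fun j => F n j p) atTop (𝓝 (M n p)))
    (hB : ∀ n (p : ℝ × ℝ), p.2 ≠ 0 → ∃ B : ℝ, ∀ᶠ q in 𝓝 p, ∀ j, ‖F (n + 1) j q‖ ≤ B)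
    (n : ℕ) {p : ℝ × ℝ} (hp : p.2 ≠ 0) :
    HasFDerivAt (M n) (M (n + 1) p • X + M (n + 2) p • Y) p := by
  obtain ⟨B₂, h₂⟩ := hB (n + 1) p hp
  obtain ⟨B₃, h₃⟩ := hB (n + 2) p hp
  obtain ⟨B₄, h₄⟩ := hB (n + 3) p hp
  obtain ⟨r, hr, hball⟩ :=
    Metric.eventually_nhds_iff_ball.1 ((h₂.and h₃).and (h₄.and (eventually_snd_ne_zero hp)))
  set B := max B₂ (max B₃ B₄)
  set S := ‖X‖ + ‖Y‖
  have hS : 0 ≤ S := by positivity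
  have hlip (i : ℕ) (hi : ∀ q ∈ Metric.ball p r, ∀ j, ‖F (i + 1) j q‖ ≤ B ∧ ‖F (i + 2) j q‖ ≤ B)
      (j : ℕ) {q : ℝ × ℝ} (hq : q ∈ Metric.ball p r) :
      ‖F i j q - F i j p‖ ≤ B * S * ‖q - p‖ :=
    (convex_ball p r).norm_image_sub_le_of_norm_hasFDerivWithin_le
      (fun x _ => (hF i j x).hasFDerivWithinAt)
      (fun x hx => norm_smul_add_smul_le _ _ (hi x hx j).1 (hi x hx j).2)
      (Metric.mem_ball_self hr) hq
  have hlip₁ := hlip (n + 1) fun q hq j =>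
    ⟨((hball q hq).1.1 j).trans (le_max_left _ _),
      ((hball q hq).1.2 j).trans ((le_max_left _ _).trans (le_max_right _ _))⟩
  have hlip₂ := hlip (n + 2) fun q hq j =>
    ⟨((hball q hq).1.2 j).trans ((le_max_left _ _).trans (le_max_right _ _)),
      ((hball q hq).2.1 j).trans ((le_max_right _ _).trans (le_max_right _ _))⟩
  have hBS : 0 ≤ B * S :=
    mul_nonneg ((norm_nonneg _).trans
      (((hball p (Metric.mem_ball_self hr)).1.1 0).trans (le_max_left _ _))) hS
  have hrem : ∀ q ∈ Metric.ball p r,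
      ‖M n q - M n p - (M (n + 1) p • X + M (n + 2) p • Y) (q - p)‖ ≤
        B * S * S * ‖‖q - p‖ ^ 2‖ := by
    intro q hq
    have hlim : Tendsto
        (fun j => ‖F n j q - F n j p - (F (n + 1) j p • X + F (n + 2) j p • Y) (q - p)‖) atTop
        (𝓝 ‖M n q - M n p - (M (n + 1) p • X + M (n + 2) p • Y) (q - p)‖) := by
      simp only [add_apply, smul_apply]
      exact (((hM n q (hball q hq).2.2).sub (hM n p hp)).sub
        (((hM (n + 1) p hp).smul_const _).add ((hM (n + 2) p hp).smul_const _))).norm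
    refine le_of_tendsto' hlim fun j => ?_
    have hsub : Metric.closedBall p ‖q - p‖ ⊆ Metric.ball p r :=
      Metric.closedBall_subset_ball (by simpa [dist_eq_norm] using hq)
    have hmv := (convex_closedBall p ‖q - p‖).norm_image_sub_le_of_norm_hasFDerivWithin_le'
      (f := F n j) (φ := F (n + 1) j p • X + F (n + 2) j p • Y) (C := B * S * ‖q - p‖ * S)
      (fun x _ => (hF n j x).hasFDerivWithinAt) (fun x hx => ?_)
      (Metric.mem_closedBall_self (norm_nonneg _))
      (show q ∈ Metric.closedBall p ‖q - p‖ by simp [dist_eq_norm])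
    · refine hmv.trans (le_of_eq ?_)
      rw [norm_pow, norm_norm]
      ring
    · have hx' : ‖x - p‖ ≤ ‖q - p‖ := by simpa [dist_eq_norm] using hx
      rw [add_sub_add_comm, ← sub_smul, ← sub_smul]
      exact norm_smul_add_smul_le _ _
        ((hlip₁ j (hsub hx)).trans (mul_le_mul_of_nonneg_left hx' hBS))
        ((hlip₂ j (hsub hx)).trans (mul_le_mul_of_nonneg_left hx' hBS))
  refine .of_isLittleO (Asymptotics.IsBigO.trans_isLittleO ?_
    (Asymptotics.isLittleO_pow_sub_sub p one_lt_two))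
  exact .of_bound (B * S * S) (Metric.eventually_nhds_iff_ball.2 ⟨r, hr, hrem⟩)

lemma isOpen_snd_ne_zero : IsOpen {p : ℝ × ℝ | p.2 ≠ 0} :=
  isOpen_ne_fun continuous_snd continuous_const

lemma contDiffOn_of_hasFDerivAt_shift
    (hM : ∀ n (p : ℝ × ℝ), p.2 ≠ 0 → HasFDerivAt (M n) (M (n + 1) p • X + M (n + 2) p • Y) p)
    (n : ℕ) : ContDiffOn ℝ (⊤ : ℕ∞) (M n) {p : ℝ × ℝ | p.2 ≠ 0} := by
  refine contDiffOn_infty.2 fun r => ?_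
  induction r generalizing n with
  | zero =>
    exact contDiffOn_zero.2 fun p hp => (hM n p hp).continuousAt.continuousWithinAt
  | succ r ih =>
    push_cast
    rw [contDiffOn_succ_iff_fderiv_of_isOpen isOpen_snd_ne_zero]
    refine ⟨fun p hp => (hM n p hp).differentiableAt.differentiableWithinAt, by simp, ?_⟩
    exact (((ih (n + 1)).smul contDiffOn_const).add ((ih (n + 2)).smul contDiffOn_const)).congr
      fun p hp => (hM n p hp).fderiv

end SmoothLimit

lemma iteratedDeriv_id_mul {g : ℝ → ℂ} (hg : ContDiff ℝ (⊤ : ℕ∞) g) (n : ℕ) :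
    iteratedDeriv (n + 1) (fun t : ℝ => (t : ℂ) * g t) =
      fun t : ℝ => (t : ℂ) * iteratedDeriv (n + 1) g t + (n + 1) * iteratedDeriv n g t := by
  have hd (m : ℕ) (t : ℝ) : HasDerivAt (iteratedDeriv m g) (iteratedDeriv (m + 1) g t) t := by
    rw [iteratedDeriv_succ]
    exact (hg.differentiable_iteratedDeriv m (by exact_mod_cast WithTop.coe_lt_top m) t).hasDerivAt
  have hmul (m : ℕ) (t : ℝ) : HasDerivAt (fun t : ℝ => (t : ℂ) * iteratedDeriv m g t)
      (iteratedDeriv m g t + (t : ℂ) * iteratedDeriv (m + 1) g t) t := by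
    exact ((hasDerivAt_id t).ofReal_comp.mul (hd m t)).congr_deriv (by simp)
  induction n with
  | zero =>
    ext t
    rw [zero_add, iteratedDeriv_one]
    refine ((hmul 0 t).deriv).trans ?_
    simp [add_comm]
  | succ n ih =>
    rw [iteratedDeriv_succ, ih]
    ext t
    refine ((hmul (n + 1) t).add ((hd n t).const_mul ((n : ℂ) + 1))).deriv.trans ?_
    push_cast
    ring

/-- A smooth regularization `q` of `1/t`, vanishing near `0`. -/
lemma exists_regularized_inv : ∃ ψ q : ℝ → ℂ, ContDiff ℝ (⊤ : ℕ∞) ψ ∧ HasCompactSupport ψ ∧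
    ContDiff ℝ (⊤ : ℕ∞) q ∧ (∀ t, ψ t + t * q t = 1) ∧ (∀ t, |t| < 1 → q t = 0) ∧
    ∀ α, ∃ C : ℝ, ∀ t, ‖iteratedDeriv α q t‖ * (1 + |t|) ≤ C := by
  obtain ⟨ψ₀, hψ₀, hs₀, h1, -⟩ := exists_smooth_cutoff one_pos
  let ψ : ℝ → ℂ := fun t => (ψ₀ t : ℂ)
  have hψ : ContDiff ℝ (⊤ : ℕ∞) ψ := Complex.ofRealCLM.contDiff.comp hψ₀
  have hs : HasCompactSupport ψ := hs₀.comp_left Complex.ofReal_zero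
  let q : ℝ → ℂ := fun t => (1 - ψ t) / t
  have hq0 : ∀ t, |t| < 1 → q t = 0 := fun t ht => by simp [q, ψ, h1 t ht.le]
  have hq : ContDiff ℝ (⊤ : ℕ∞) q := by
    rw [contDiff_iff_contDiffAt]
    intro t
    by_cases ht : t = 0
    · refine (contDiffAt_const (c := (0 : ℂ))).congr_of_eventuallyEq ?_
      filter_upwards [continuous_abs.continuousAt.eventually_lt_const
        (show |t| < 1 by simp [ht])] with s hs using hq0 s hs
    · simp only [q, div_eq_mul_inv]
      exact (contDiffAt_const.sub hψ.contDiffAt).mul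
        (Complex.ofRealCLM.contDiff.contDiffAt.inv (by simpa using ht))
  have hψq : ∀ t, ψ t + t * q t = 1 := by
    intro t
    by_cases ht : t = 0
    · simp [ht, ψ, h1]
    · have : (t : ℂ) ≠ 0 := by exact_mod_cast ht
      simp only [q]
      field_simp
      ring
  refine ⟨ψ, q, hψ, hs, hq, hψq, hq0, fun α => ?_⟩
  have hbdd (α : ℕ) {A : ℝ} (hA : ∀ t : ℝ, ‖(t : ℂ) * iteratedDeriv α q t‖ ≤ A) :
      ∃ C : ℝ, ∀ t, ‖iteratedDeriv α q t‖ * (1 + |t|) ≤ C := by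
    obtain ⟨D, hD⟩ := isCompact_Icc.exists_bound_of_continuousOn (s := Set.Icc (-1 : ℝ) 1)
      (hq.continuous_iteratedDeriv α (by exact_mod_cast le_top)).continuousOn
    have hA' (t : ℝ) : ‖iteratedDeriv α q t‖ * |t| ≤ A := by
      simpa [mul_comm] using hA t
    refine ⟨max D A + A, fun t => ?_⟩
    rw [mul_add, mul_one]
    refine add_le_add ?_ (hA' t)
    rcases le_total |t| 1 with ht | ht
    · exact (hD t (abs_le.1 ht)).trans (le_max_left _ _)
    · exact ((le_mul_of_one_le_right (norm_nonneg _) ht).trans (hA' t)).trans (le_max_right _ _)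
  have hψb (m : ℕ) : ∃ A, ∀ t, ‖iteratedDeriv m ψ t‖ ≤ A := by
    obtain ⟨A, hA⟩ := (hψ.continuous_iteratedFDeriv
      (m := m) (by exact_mod_cast le_top)).bounded_above_of_compact_support (hs.iteratedFDeriv m)
    exact ⟨A, fun t => by simpa only [norm_iteratedFDeriv_eq_norm_iteratedDeriv] using hA t⟩
  have hmul : (fun t : ℝ => (t : ℂ) * q t) = fun t => 1 - ψ t := by
    ext t
    rw [← hψq t, add_sub_cancel_left]
  induction α with
  | zero =>
    obtain ⟨A, hA⟩ := hψb 0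
    refine hbdd 0 (A := 1 + A) fun t => ?_
    rw [iteratedDeriv_zero, congrFun hmul t]
    simpa using (norm_sub_le (1 : ℂ) (ψ t)).trans
      (add_le_add (by simp) (by simpa using hA t))
  | succ n ih =>
    obtain ⟨C, hC⟩ := ih
    obtain ⟨A, hA⟩ := hψb (n + 1)
    refine hbdd (n + 1) (A := A + (n + 1) * C) fun t => ?_
    have h := congrFun (iteratedDeriv_id_mul hq n) t
    rw [hmul, iteratedDeriv_const_sub (by simp)] at h
    have h' : (t : ℂ) * iteratedDeriv (n + 1) q t =
        -iteratedDeriv (n + 1) ψ t - (n + 1) * iteratedDeriv n q t := by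
      rw [eq_sub_iff_add_eq, ← h, iteratedDeriv_neg]
    rw [h']
    refine (norm_sub_le _ _).trans (add_le_add (by simpa using hA t) ?_)
    rw [norm_mul]
    have hn : ‖(n + 1 : ℂ)‖ = n + 1 := by exact_mod_cast Complex.norm_natCast (n + 1)
    rw [hn]
    refine mul_le_mul_of_nonneg_left (le_trans ?_ (hC t)) (by positivity)
    exact le_mul_of_one_le_right (norm_nonneg _) (by linarith [abs_nonneg t])

section Kernels

variable {Cd : ℕ → ℝ} {C : ℝ} {ε N : ℕ → ℝ} {k : ℕ → ℝ → ℂ}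

lemma IsTruncCZ.hasCompactSupport {ε N : ℝ} {k : ℝ → ℂ} (h : IsTruncCZ Cd C ε N k) :
    HasCompactSupport k := by
  refine .intro (isCompact_Icc (a := -N) (b := N)) fun t ht => h.2.1 t fun h' => ht ?_
  exact abs_le.1 h'.2

lemma IsTruncCZ.norm_iteratedDeriv_le {ε N : ℝ} {k : ℝ → ℂ} (h : IsTruncCZ Cd C ε N k) (α : ℕ)
    {t : ℝ} (ht : 1 ≤ |t|) : ‖iteratedDeriv α k t‖ ≤ |Cd α| * |t|⁻¹ := by
  refine (h.2.2.1 α t (by rintro rfl; norm_num at ht)).trans ?_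
  rw [← Real.rpow_neg_one]
  refine mul_le_mul (le_abs_self _) ?_ (by positivity) (abs_nonneg _)
  exact Real.rpow_le_rpow_of_exponent_le ht (by linarith [(Nat.cast_nonneg α : (0 : ℝ) ≤ α)])

lemma IsTruncCZ.norm_mul_self_le {ε N : ℝ} {k : ℝ → ℂ} (h : IsTruncCZ Cd C ε N k) (t : ℝ) :
    ‖(t : ℂ) * k t‖ ≤ |Cd 0| := by
  rcases eq_or_ne t 0 with rfl | ht
  · simp
  · have h0 := h.2.2.1 0 t ht
    have ht' : 0 < |t| := abs_pos.2 ht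
    rw [iteratedDeriv_zero, Nat.cast_zero, sub_zero, Real.rpow_neg_one] at h0
    rw [norm_mul, Complex.norm_real, Real.norm_eq_abs]
    calc |t| * ‖k t‖ ≤ |t| * (Cd 0 * |t|⁻¹) := by gcongr
      _ = Cd 0 := by field_simp
      _ ≤ |Cd 0| := le_abs_self _

lemma isDecaying_regularized_inv_mul (hk : ∀ j, IsTruncCZ Cd C (ε j) (N j) (k j))
    (hconv : TestConvergent k) {q : ℝ → ℂ} (hq : ContDiff ℝ (⊤ : ℕ∞) q)
    (hq0 : ∀ t, |t| < 1 → q t = 0)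
    (hqb : ∀ α, ∃ C : ℝ, ∀ t, ‖iteratedDeriv α q t‖ * (1 + |t|) ≤ C) :
    IsDecaying (fun j t => q t * k j t) where
  contDiff j := hq.mul (hk j).1
  hasCompactSupport j := (hk j).hasCompactSupport.mul_left
  testConvergent := hconv.mul_left hq
  decay α := by
    choose A hA using hqb
    have hA0 (i : ℕ) : 0 ≤ A i := le_trans (by positivity) (hA i 0)
    refine ⟨∑ i ∈ Finset.range (α + 1), (α.choose i : ℝ) * A i * (|Cd (α - i)| * 2),
      fun j t => ?_⟩
    rcases lt_or_ge |t| 1 with ht | ht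
    · have hz : (fun s => q s * k j s) =ᶠ[𝓝 t] fun _ => 0 := by
        filter_upwards [continuous_abs.continuousAt.eventually_lt_const ht] with s hs
        rw [hq0 s hs, zero_mul]
      rw [hz.iteratedDeriv_eq]
      simp only [iteratedDeriv_fun_const_zero, norm_zero]
      have := Finset.sum_nonneg fun i (_ : i ∈ Finset.range (α + 1)) =>
        mul_nonneg (mul_nonneg (Nat.cast_nonneg (α.choose i)) (hA0 i))
          (mul_nonneg (abs_nonneg (Cd (α - i))) zero_le_two)
      positivity
    · rw [← norm_iteratedFDeriv_eq_norm_iteratedDeriv, Finset.sum_mul]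
      refine (norm_iteratedFDeriv_mul_le hq (hk j).1 t (by exact_mod_cast le_top)).trans
        (Finset.sum_le_sum fun i _ => ?_)
      rw [norm_iteratedFDeriv_eq_norm_iteratedDeriv, norm_iteratedFDeriv_eq_norm_iteratedDeriv]
      have h1 : ‖iteratedDeriv i q t‖ ≤ A i * (1 + |t|)⁻¹ := by
        rw [← div_eq_mul_inv, le_div_iff₀ (by positivity)]
        exact hA i t
      have h2 := (hk j).norm_iteratedDeriv_le (α - i) ht
      have h3 : (1 + |t|)⁻¹ * |t|⁻¹ ≤ 2 * (1 + t ^ 2)⁻¹ := by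
        rw [← mul_inv, ← div_eq_mul_inv, inv_eq_one_div, div_le_div_iff₀ (by positivity)
          (by positivity), ← sq_abs t]
        nlinarith
      calc (α.choose i : ℝ) * ‖iteratedDeriv i q t‖ * ‖iteratedDeriv (α - i) (k j) t‖
          ≤ α.choose i * (A i * (1 + |t|)⁻¹) * (|Cd (α - i)| * |t|⁻¹) := by
            have := hA0 i
            gcongr
        _ = α.choose i * A i * |Cd (α - i)| * ((1 + |t|)⁻¹ * |t|⁻¹) := by ring
        _ ≤ α.choose i * A i * |Cd (α - i)| * (2 * (1 + t ^ 2)⁻¹) := by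
            have := hA0 i
            gcongr
        _ = _ := by ring

/-- All moments of the oscillatory integrals of the kernels converge, and those of positive order
are locally bounded. -/
lemma oscInt_moment_limits (hk : ∀ j, IsTruncCZ Cd C (ε j) (N j) (k j))
    (hconv : TestConvergent k) (n : ℕ) (p : ℝ × ℝ) (hp : p.2 ≠ 0) :
    (∃ L, Tendsto (fun j => oscInt (fun t => (t : ℂ) ^ n * k j t) p) atTop (𝓝 L)) ∧
      ∃ B : ℝ, ∀ᶠ q in 𝓝 p, ∀ j, ‖oscInt (fun t => (t : ℂ) ^ (n + 1) * k j t) q‖ ≤ B := by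
  obtain ⟨ψ, q, hψ, hs, hq, hψq, hq0, hqb⟩ := exists_regularized_inv
  have hfar (m : ℕ) := IsDecaying.isControlled_oscInt_pow_mul (m + 1)
    (isDecaying_regularized_inv_mul hk hconv hq hq0 hqb) p hp
  have hpow (m : ℕ) : ContDiff ℝ (⊤ : ℕ∞) fun t : ℝ => (t : ℂ) ^ m :=
    Complex.ofRealCLM.contDiff.pow m
  have hsplit (m j : ℕ) (p : ℝ × ℝ) : oscInt (fun t => (t : ℂ) ^ m * k j t) p =
      oscInt (fun t => (t : ℂ) ^ m * ψ t * k j t) p +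
        oscInt (fun t => (t : ℂ) ^ (m + 1) * (q t * k j t)) p := by
    have hkc := (hk j).1.continuous
    have hψc := hψ.continuous
    have hqc := hq.continuous
    rw [← oscInt_add]
    rotate_left
    · fun_prop
    · exact (hk j).hasCompactSupport.mul_left
    · fun_prop
    · exact (hk j).hasCompactSupport.mul_left.mul_left
    congr 1
    ext t
    linear_combination (-(t : ℂ) ^ m * k j t) * hψq t
  constructor
  · obtain ⟨⟨L, hL⟩, -⟩ := hfar n
    obtain ⟨L', hL'⟩ := hconv.oscInt_tendsto ((hpow n).mul hψ) hs.mul_left p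
    exact ⟨L' + L, by simpa only [hsplit] using hL'.add hL⟩
  · obtain ⟨-, B, hB⟩ := hfar (n + 1)
    have hbI : Integrable fun t : ℝ => ‖(t : ℂ) ^ n * ψ t‖ * |Cd 0| :=
      (integrable_mul_of_hasCompactSupport (hpow n).continuous hψ.continuous hs).norm.mul_const _
    refine ⟨(∫ t : ℝ, ‖(t : ℂ) ^ n * ψ t‖ * |Cd 0|) + B, ?_⟩
    filter_upwards [hB] with x hx j
    rw [hsplit]
    refine (norm_add_le _ _).trans (add_le_add (norm_oscInt_le hbI (fun t => ?_) x) (hx j))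
    calc ‖(t : ℂ) ^ (n + 1) * ψ t * k j t‖ = ‖(t : ℂ) ^ n * ψ t‖ * ‖(t : ℂ) * k j t‖ := by
          rw [← norm_mul]
          congr 1
          ring
      _ ≤ _ := mul_le_mul_of_nonneg_left ((hk j).norm_mul_self_le t) (norm_nonneg _)

end Kernels

/-- If `k j` are truncated CZ kernels with uniform constants, inner radii
tending to `0` and outer radii tending to `∞`, converging in the space of tempered
distributions, then the multipliers `m j (ξ,η) = ∫ e^{-2πi(tξ+t²η)} k j t dt` converge
pointwise for `η ≠ 0`, and the limit is `C^∞` on `{η ≠ 0}`. -/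
theorem multiplier_limit_exists_and_smooth (Cd : ℕ → ℝ) (C : ℝ)
    (ε N : ℕ → ℝ) (k : ℕ → ℝ → ℂ)
    (hεN : ∀ j, 0 < ε j ∧ ε j < N j)
    (hε : Tendsto ε atTop (𝓝 0)) (hN : Tendsto N atTop atTop)
    (hk : ∀ j, IsTruncCZ Cd C (ε j) (N j) (k j))
    (hconv : ∀ φ : SchwartzMap ℝ ℂ, ∃ L : ℂ,
      Tendsto (fun j => ∫ t : ℝ, k j t * φ t) atTop (𝓝 L)) :
    ∃ m : ℝ → ℝ → ℂ,
      (∀ ξ η : ℝ, η ≠ 0 →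
        Tendsto (fun j => ∫ t : ℝ, eI (-2 * π * (t * ξ + t ^ 2 * η)) * k j t)
          atTop (𝓝 (m ξ η))) ∧
      ContDiffOn ℝ (⊤ : ℕ∞) (fun p : ℝ × ℝ => m p.1 p.2) {p : ℝ × ℝ | p.2 ≠ 0} := by
  have htest : TestConvergent k := fun φ hφ hs => by
    simpa using hconv (hs.toSchwartzMap hφ)
  have hlim := oscInt_moment_limits hk htest
  let M : ℕ → ℝ × ℝ → ℂ := fun n p =>
    limUnder atTop fun j => oscInt (fun t => (t : ℂ) ^ n * k j t) p
  have hM (n : ℕ) (p : ℝ × ℝ) (hp : p.2 ≠ 0) :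
      Tendsto (fun j => oscInt (fun t => (t : ℂ) ^ n * k j t) p) atTop (𝓝 (M n p)) :=
    tendsto_nhds_limUnder (hlim n p hp).1
  refine ⟨fun ξ η => M 0 (ξ, η), fun ξ η hη => ?_, ?_⟩
  · simpa [oscInt] using hM 0 (ξ, η) hη
  · refine contDiffOn_of_hasFDerivAt_shift (M := M) (X := phaseFst) (Y := phaseSnd)
      (fun n p hp => hasFDerivAt_limit (F := fun n j => oscInt fun t => (t : ℂ) ^ n * k j t)
        (fun n j p => ?_) hM (fun n p hp => (hlim n p hp).2) n hp) 0
    have hkc := (hk j).1.continuous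
    have h := hasFDerivAt_oscInt (g := fun t => (t : ℂ) ^ n * k j t) (by fun_prop)
      (hk j).hasCompactSupport.mul_left p
    simpa only [← mul_assoc, ← pow_succ', ← pow_add, add_comm 2 n] using h
end
end
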